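/- If q ≡ 1 (mod 4) is a prime power and there exists a Hadamard matrix of order q − 1, then there exists a Hadamard matrix of order 4q. -/

import Mathlib

/-- A Hadamard matrix of order `n`: entries `±1` and `H * Hᵀ = n • I`. -/
def IsHadamard (n : ℕ) (H : Matrix (Fin n) (Fin n) ℤ) : Prop :=
  (∀ i j, H i j = 1 ∨ H i j = -1) ∧ H * H.transpose = (n : ℤ) • 1

/-- A conference matrix of order `n`: zero diagonal, off-diagonal entries `±1`,
and `C * Cᵀ = (n - 1) • I`. -/
def IsConference (n : ℕ) (C : Matrix (Fin n) (Fin n) ℤ) : Prop :=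
  (∀ i, C i i = 0) ∧ (∀ i j, i ≠ j → C i j = 1 ∨ C i j = -1) ∧
    C * C.transpose = ((n : ℤ) - 1) • 1

open scoped Matrix

/-- The integer sign attached to a Boolean. -/
def boolSign (b : Bool) : ℤ := if b then 1 else -1

/-- The Sylvester Hadamard matrix of order four, as a character table. -/
def sylvesterFour : Matrix (Bool × Bool) (Bool × Bool) ℤ := fun i a =>
  (if i.1 then boolSign a.1 else 1) * (if i.2 then boolSign a.2 else 1)

/-- The regular Hadamard matrix of order four. -/
def regularFour : Matrix (Bool × Bool) (Bool × Bool) ℤ := fun a k => if a = k then -1 else 1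

/-- A Hadamard matrix of order four for which
`sylvesterFour * regularFourᵀ = 2 • borderFour * D`, with `D` the diagonal matrix of the signs
`boolSign a.1`. -/
def borderFour : Matrix (Bool × Bool) (Bool × Bool) ℤ := fun i a =>
  boolSign a.1 * (if i = (false, false) then 1 else -sylvesterFour i a)

theorem sylvesterFour_eq_or (i a) : sylvesterFour i a = 1 ∨ sylvesterFour i a = -1 := by
  rcases i with ⟨_ | _, _ | _⟩ <;> rcases a with ⟨_ | _, _ | _⟩ <;> decide

theorem regularFour_eq_or (a k) : regularFour a k = 1 ∨ regularFour a k = -1 := by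
  rcases a with ⟨_ | _, _ | _⟩ <;> rcases k with ⟨_ | _, _ | _⟩ <;> decide

theorem borderFour_eq_or (i a) : borderFour i a = 1 ∨ borderFour i a = -1 := by
  rcases i with ⟨_ | _, _ | _⟩ <;> rcases a with ⟨_ | _, _ | _⟩ <;> decide

theorem sum_sylvesterFour (i j) :
    ∑ k, sylvesterFour i k * sylvesterFour j k = if i = j then 4 else 0 := by
  revert i j; decide

theorem sum_regularFour (a b) :
    ∑ k, regularFour a k * regularFour b k = if a = b then 4 else 0 := by
  revert a b; decide

theorem sum_borderFour (i j) :
    ∑ a, borderFour i a * borderFour j a = if i = j then 4 else 0 := by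
  revert i j; decide

theorem sum_sylvesterFour_mul_regularFour (i a) :
    ∑ k, sylvesterFour i k * regularFour a k = 2 * (boolSign a.1 * borderFour i a) := by
  revert i a; decide

section Core

variable {G : Type*} [DecidableEq G]

/-- Two diagonal copies of `P`. -/
def doubleBlock (P : Matrix G G ℤ) : Matrix (Bool × G) (Bool × G) ℤ := fun i j =>
  if i.1 = j.1 then P i.2 j.2 else 0

/-- The block matrix with identity diagonal blocks and off-diagonal blocks `K` and `-Kᵀ`. -/
def skewBlock (K : Matrix G G ℤ) : Matrix (Bool × G) (Bool × G) ℤ := fun i j =>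
  if i.1 = j.1 then (if i.2 = j.2 then 1 else 0)
  else if j.1 then K i.2 j.2 else -K j.2 i.2

variable [Fintype G]

omit [DecidableEq G] in
theorem sum_doubleBlock (P : Matrix G G ℤ) (i j : Bool × G) :
    ∑ k, doubleBlock P i k * doubleBlock P j k =
      if i.1 = j.1 then ∑ z, P i.2 z * P j.2 z else 0 := by
  obtain ⟨c, x⟩ := i
  obtain ⟨d, y⟩ := j
  cases c <;> cases d <;> simp [doubleBlock, Fintype.sum_prod_type]

theorem sum_skewBlock {m : ℤ} {K : Matrix G G ℤ} (hK : K * Kᵀ = m • 1) (hK' : Kᵀ * K = m • 1)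
    (i j : Bool × G) :
    ∑ k, skewBlock K i k * skewBlock K j k = if i = j then m + 1 else 0 := by
  obtain ⟨c, x⟩ := i
  obtain ⟨d, y⟩ := j
  have h1 := congrFun (congrFun hK x) y
  have h2 := congrFun (congrFun hK' x) y
  simp only [Matrix.mul_apply, Matrix.transpose_apply, Matrix.smul_apply, Matrix.one_apply] at h1 h2
  cases c <;> cases d <;> simp [skewBlock, Fintype.sum_prod_type, h1, h2, eq_comm (a := y)] <;>
    split_ifs <;> simp_all [add_comm]

/-- The matrix of order `4 * (2 * n + 1)` assembled from a core `P` of order `2 * n`, a Hadamard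
matrix `K` of order `2 * n`, and a border of width four. -/
def borderedMatrix (σ : G → Bool) (P K : Matrix G G ℤ) :
    Matrix ((Bool × Bool) ⊕ (Bool × (Bool × G))) ((Bool × Bool) ⊕ (Bool × (Bool × G))) ℤ :=
  fun r t => match r, t with
  | .inl i, .inl k => sylvesterFour i k
  | .inl i, .inr (_, c, y) => borderFour i (σ y, c)
  | .inr (_, c, x), .inl k => regularFour (σ x, c) k
  | .inr (d, i), .inr (e, j) => doubleBlock P i j + boolSign d * boolSign e * skewBlock K i j

omit [Fintype G] in
theorem borderedMatrix_eq_or (σ : G → Bool) {P K : Matrix G G ℤ}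
    (hP0 : ∀ x, P x x = 0) (hP1 : ∀ x y, x ≠ y → P x y = 1 ∨ P x y = -1)
    (hK1 : ∀ x y, K x y = 1 ∨ K x y = -1) (i j) :
    borderedMatrix σ P K i j = 1 ∨ borderedMatrix σ P K i j = -1 := by
  rcases i with i | ⟨d, c, x⟩ <;> rcases j with j | ⟨d', c', y⟩
  · exact sylvesterFour_eq_or _ _
  · exact borderFour_eq_or _ _
  · exact regularFour_eq_or _ _
  · have hxy := hP1 x y
    have h1 := hK1 x y
    have h2 := hK1 y x
    simp only [borderedMatrix]
    by_cases h : x = y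
    · subst h
      cases d <;> cases d' <;> cases c <;> cases c' <;>
        simp [doubleBlock, skewBlock, boolSign, hP0] <;> omega
    · have := hxy h
      cases d <;> cases d' <;> cases c <;> cases c' <;>
        simp [doubleBlock, skewBlock, boolSign, h] <;> omega

theorem sum_borderedMatrix {n : ℤ} {σ : G → Bool} {P K : Matrix G G ℤ}
    (hσ : ∀ g : Bool → ℤ, ∑ x, g (σ x) = n * (g true + g false))
    (hPσ : ∀ (g : Bool → ℤ) x, ∑ y, P x y * g (σ y) = -(boolSign (σ x) * g (σ x)))
    (hP : ∀ x y, ∑ z, P x z * P y z =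
      (if x = y then 2 * n + 1 else 0) - (if σ x = σ y then 2 else 0))
    (hK : K * Kᵀ = (2 * n) • 1) (hK' : Kᵀ * K = (2 * n) • 1) (i j) :
    ∑ k, borderedMatrix σ P K i k * borderedMatrix σ P K j k =
      if i = j then 4 * (2 * n + 1) else 0 := by
  have border (i : Bool × Bool) (d c : Bool) (x : G) :
      ∑ k, borderedMatrix σ P K (Sum.inl i) k * borderedMatrix σ P K (Sum.inr (d, c, x)) k = 0 := by
    have h := sum_sylvesterFour_mul_regularFour i (σ x, c)
    have h' := hPσ (fun s => borderFour i (s, c)) x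
    rw [Fintype.sum_sum_type]
    simp only [borderedMatrix, h]
    rw [Fintype.sum_prod_type, Fintype.sum_bool, ← Finset.sum_add_distrib]
    have key : ∀ t : Bool × G, borderFour i (σ t.2, t.1) *
          (doubleBlock P (c, x) t + boolSign d * boolSign true * skewBlock K (c, x) t) +
        borderFour i (σ t.2, t.1) *
          (doubleBlock P (c, x) t + boolSign d * boolSign false * skewBlock K (c, x) t) =
        2 * (doubleBlock P (c, x) t * borderFour i (σ t.2, t.1)) := by
      intro t
      simp only [boolSign, if_true, Bool.false_eq_true, if_false]
      ring
    simp only [key, ← Finset.mul_sum]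
    rw [Fintype.sum_prod_type, Fintype.sum_bool]
    cases c <;> simp [doubleBlock, h']
  rcases i with i | ⟨d, c, x⟩ <;> rcases j with j | ⟨d', c', y⟩
  · have h := sum_borderFour i j
    rw [Fintype.sum_prod_type, Fintype.sum_bool, Fintype.sum_bool, Fintype.sum_bool] at h
    rw [Fintype.sum_sum_type]
    simp only [borderedMatrix, sum_sylvesterFour,
      Fintype.sum_prod_type (α₁ := Bool) (α₂ := Bool × G),
      Fintype.sum_prod_type (α₁ := Bool) (α₂ := G), Fintype.sum_bool,
      hσ (fun s => borderFour i (s, true) * borderFour j (s, true)),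
      hσ (fun s => borderFour i (s, false) * borderFour j (s, false)), Sum.inl.injEq]
    split_ifs at h ⊢ <;> linear_combination 2 * n * h
  · simpa using border i d' c' y
  · simpa [mul_comm] using border j d c x
  · rw [Fintype.sum_sum_type]
    simp only [borderedMatrix, sum_regularFour]
    rw [Fintype.sum_prod_type, Fintype.sum_bool, ← Finset.sum_add_distrib]
    have key : ∀ t : Bool × G,
        (doubleBlock P (c, x) t + boolSign d * boolSign true * skewBlock K (c, x) t) *
          (doubleBlock P (c', y) t + boolSign d' * boolSign true * skewBlock K (c', y) t) +
        (doubleBlock P (c, x) t + boolSign d * boolSign false * skewBlock K (c, x) t) *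
          (doubleBlock P (c', y) t + boolSign d' * boolSign false * skewBlock K (c', y) t) =
        2 * (doubleBlock P (c, x) t * doubleBlock P (c', y) t) +
          2 * (boolSign d * boolSign d') * (skewBlock K (c, x) t * skewBlock K (c', y) t) := by
      intro t
      simp only [boolSign, if_true, Bool.false_eq_true, if_false]
      ring
    simp only [key, Finset.sum_add_distrib, ← Finset.mul_sum, sum_doubleBlock,
      sum_skewBlock hK hK', hP, Sum.inr.injEq, Prod.mk.injEq]
    by_cases hxy : x = y
    · subst hxy
      cases d <;> cases d' <;> cases c <;> cases c' <;> simp [boolSign] <;> ring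
    · by_cases hs : σ x = σ y <;> by_cases hc : c = c' <;> simp [hxy, hs, hc]

end Core

section FiniteField

variable {F : Type*} [Field F] [Fintype F] [DecidableEq F]

theorem sum_quadraticChar_sub_mul_sub (hF : ringChar F ≠ 2) (a b : F) :
    ∑ z, quadraticChar F (a - z) * quadraticChar F (b - z) =
      if a = b then (Fintype.card F : ℤ) - 1 else -1 := by
  split_ifs with h
  · subst h
    rw [← (Equiv.subLeft a).sum_comp]
    have : ∀ t : F, quadraticChar F (a - Equiv.subLeft a t) *
        quadraticChar F (a - Equiv.subLeft a t) = 1 - if t = 0 then 1 else 0 := by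
      intro t
      rw [Equiv.subLeft_apply, sub_sub_cancel]
      by_cases ht : t = 0
      · simp [ht]
      · rw [← sq, quadraticChar_sq_one ht]; simp [ht]
    rw [Finset.sum_congr rfl fun t _ => this t]
    simp
  · have hd : a - b ≠ 0 := sub_ne_zero.mpr h
    have hJ := jacobiSum_nontrivial_inv (quadraticChar_ne_one hF)
    rw [(quadraticChar_isQuadratic F).inv, jacobiSum] at hJ
    rw [← ((Equiv.mulLeft₀ (a - b) hd).trans (Equiv.subLeft a)).sum_comp]
    have : ∀ t : F, quadraticChar F (a - (a - (a - b) * t)) *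
        quadraticChar F (b - (a - (a - b) * t)) =
        quadraticChar F (-1) * (quadraticChar F t * quadraticChar F (1 - t)) := by
      intro t
      rw [show a - (a - (a - b) * t) = (a - b) * t by ring,
        show b - (a - (a - b) * t) = (a - b) * (-1 * (1 - t)) by ring]
      simp only [map_mul]
      linear_combination (quadraticChar F t * quadraticChar F (-1) * quadraticChar F (1 - t)) *
        quadraticChar_sq_one hd
    refine (Finset.sum_congr rfl fun t _ => this t).trans ?_
    rw [← Finset.mul_sum, hJ]
    linear_combination - quadraticChar_sq_one (F := F) (neg_ne_zero.mpr one_ne_zero)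

/-- The quadratic residue class of a nonzero element. -/
def residueClass (x : {x : F // x ≠ 0}) : Bool := decide (quadraticChar F x = 1)

theorem boolSign_residueClass (x : {x : F // x ≠ 0}) :
    boolSign (residueClass x) = quadraticChar F x := by
  rcases quadraticChar_dichotomy x.2 with h | h <;> simp [boolSign, residueClass, h]

theorem sum_residueClass (hF : ringChar F ≠ 2) {n : ℤ} (hn : (Fintype.card F : ℤ) = 2 * n + 1)
    (g : Bool → ℤ) :
    ∑ x : {x : F // x ≠ 0}, g (residueClass x) = n * (g true + g false) := by
  have hg (b) : 2 * g b = (g true + g false) + (g true - g false) * boolSign b := by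
    cases b <;> simp [boolSign] <;> ring
  have h0 := quadraticChar_sum_zero hF
  rw [Fintype.sum_eq_add_sum_subtype_ne _ 0, quadraticChar_zero, zero_add] at h0
  have h1 := Fintype.sum_eq_add_sum_subtype_ne (fun _ : F => (1 : ℤ)) 0
  rw [Finset.sum_const, Finset.card_univ, nsmul_eq_mul, mul_one, hn] at h1
  apply mul_left_cancel₀ (two_ne_zero (α := ℤ))
  rw [Finset.mul_sum]
  simp only [hg, Finset.sum_add_distrib, ← Finset.mul_sum, boolSign_residueClass, h0]
  simp only [Finset.sum_const, nsmul_eq_mul] at h1 ⊢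
  linear_combination -(g true + g false) * h1

theorem sum_quadraticChar_sub_mul_residueClass (hF : ringChar F ≠ 2)
    (hneg : quadraticChar F (-1) = 1) (g : Bool → ℤ) (x : {x : F // x ≠ 0}) :
    ∑ y : {y : F // y ≠ 0}, quadraticChar F (x - y) * g (residueClass y) =
      -(boolSign (residueClass x) * g (residueClass x)) := by
  have hg (b) : 2 * g b = (g true + g false) + (g true - g false) * boolSign b := by
    cases b <;> simp [boolSign] <;> ring
  have h0 := quadraticChar_sum_zero hF
  rw [← (Equiv.subLeft (x : F)).sum_comp, Fintype.sum_eq_add_sum_subtype_ne _ 0] at h0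
  have h1 := sum_quadraticChar_sub_mul_sub hF (x : F) 0
  rw [Fintype.sum_eq_add_sum_subtype_ne _ 0, if_neg x.2] at h1
  simp only [Equiv.subLeft_apply, sub_zero, zero_sub, quadraticChar_zero, mul_zero, zero_add]
    at h0 h1
  have hy (y : F) : quadraticChar F (-y) = quadraticChar F y := by
    rw [← neg_one_mul, map_mul, hneg, one_mul]
  simp only [hy] at h1
  apply mul_left_cancel₀ (two_ne_zero (α := ℤ))
  rw [Finset.mul_sum]
  have key (y : {y : F // y ≠ 0}) : 2 * (quadraticChar F (x - y) * g (residueClass y)) =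
      (g true + g false) * quadraticChar F (x - y) +
        (g true - g false) * (quadraticChar F (x - y) * quadraticChar F y) := by
    rw [← boolSign_residueClass y]
    linear_combination quadraticChar F (x - y) * hg (residueClass y)
  have hs := quadraticChar_sq_one x.2
  have hx := hg (residueClass x)
  simp only [key, Finset.sum_add_distrib, ← Finset.mul_sum, h1]
  rw [boolSign_residueClass] at hx ⊢
  linear_combination (g true + g false) * h0 + quadraticChar F x * hx + (g true - g false) * hs

theorem sum_subtype_quadraticChar_sub_mul_sub (hF : ringChar F ≠ 2) {n : ℤ}
    (hn : (Fintype.card F : ℤ) = 2 * n + 1) (x y : {x : F // x ≠ 0}) :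
    ∑ z : {z : F // z ≠ 0}, quadraticChar F (x - z) * quadraticChar F (y - z) =
      (if x = y then 2 * n + 1 else 0) - (if residueClass x = residueClass y then 2 else 0) := by
  have h := sum_quadraticChar_sub_mul_sub hF (x : F) y
  rw [Fintype.sum_eq_add_sum_subtype_ne _ 0, sub_zero, sub_zero, hn,
    ← boolSign_residueClass, ← boolSign_residueClass] at h
  simp only [← Subtype.ext_iff] at h
  rw [← eq_sub_iff_add_eq'] at h
  rw [h]
  by_cases hxy : x = y
  · subst hxy
    cases residueClass x <;> simp [boolSign] <;> ring
  · cases residueClass x <;> cases residueClass y <;> simp [boolSign, hxy]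

end FiniteField

theorem miyamoto (q : ℕ) (hq : IsPrimePow q) (hq4 : q % 4 = 1)
    (h : ∃ H : Matrix (Fin (q - 1)) (Fin (q - 1)) ℤ, IsHadamard (q - 1) H) :
    ∃ H : Matrix (Fin (4 * q)) (Fin (4 * q)) ℤ, IsHadamard (4 * q) H := by
  classical
  obtain ⟨K, hK1, hK⟩ := h
  have hq1 : 1 < q := hq.one_lt
  obtain ⟨n, rfl⟩ : ∃ n, q = 2 * n + 1 := ⟨q / 2, by omega⟩
  obtain ⟨hFld⟩ := (Fintype.nonempty_field_iff (α := Fin (2 * n + 1))).mpr (by simpa using hq)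
  obtain ⟨F, _, _, hcard⟩ :
      ∃ (F : Type) (_ : Field F) (_ : Fintype F), Fintype.card F = 2 * n + 1 :=
    ⟨Fin (2 * n + 1), hFld, inferInstance, Fintype.card_fin _⟩
  have hF : ringChar F ≠ 2 := by
    intro h2
    have := FiniteField.even_card_iff_char_two.mp h2
    omega
  have hneg : quadraticChar F (-1) = 1 := by
    rw [quadraticChar_one_iff_isSquare (neg_ne_zero.mpr one_ne_zero),
      FiniteField.isSquare_neg_one_iff]
    omega
  have hn : (Fintype.card F : ℤ) = 2 * n + 1 := by exact_mod_cast hcard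
  have hG : Fintype.card {x : F // x ≠ 0} = 2 * n + 1 - 1 := by
    rw [Fintype.card_subtype_compl, Fintype.card_subtype_eq, hcard]
  let e := Fintype.equivFinOfCardEq hG
  have hK' : K.transpose * K = ((2 * n + 1 - 1 : ℕ) : ℤ) • 1 := by
    have := (Matrix.IsHadamard.of_mul_conjTranspose (A := K)
      (fun i j => Unitary.mem_iff_eq_one_or_eq_neg_one.mpr (hK1 i j)) (by simpa using hK)
      (by simp only [Fintype.card_fin]; exact IsRegular.of_ne_zero (by omega))).conjTranspose_mul
    simpa using this
  have hm : ((2 * n + 1 - 1 : ℕ) : ℤ) = 2 * n := by simp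
  have hLL : K.submatrix e e * (K.submatrix e e).transpose = (2 * (n : ℤ)) • 1 := by
    rw [Matrix.transpose_submatrix, Matrix.submatrix_mul_equiv, hK]
    ext
    simp only [Matrix.submatrix_apply, Matrix.smul_apply, Matrix.one_apply, e.injective.eq_iff, hm]
  have hLL' : (K.submatrix e e).transpose * K.submatrix e e = (2 * (n : ℤ)) • 1 := by
    rw [Matrix.transpose_submatrix, Matrix.submatrix_mul_equiv, hK']
    ext
    simp only [Matrix.submatrix_apply, Matrix.smul_apply, Matrix.one_apply, e.injective.eq_iff, hm]
  let P : Matrix {x : F // x ≠ 0} {x : F // x ≠ 0} ℤ := fun x y => quadraticChar F (x - y)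
  let B := borderedMatrix residueClass P (K.submatrix e e)
  have hB1 : ∀ i j, B i j = 1 ∨ B i j = -1 :=
    borderedMatrix_eq_or _ (fun x => by simp [P])
      (fun x y hxy => quadraticChar_dichotomy (sub_ne_zero.mpr (Subtype.coe_ne_coe.mpr hxy)))
      (fun x y => hK1 _ _)
  have hB := sum_borderedMatrix (P := P) (sum_residueClass hF hn)
    (sum_quadraticChar_sub_mul_residueClass hF hneg)
    (sum_subtype_quadraticChar_sub_mul_sub hF hn) hLL hLL'
  have hι : Fintype.card ((Bool × Bool) ⊕ (Bool × (Bool × {x : F // x ≠ 0}))) =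
      4 * (2 * n + 1) := by
    rw [Fintype.card_sum, Fintype.card_prod, Fintype.card_prod, Fintype.card_prod, hG,
      Fintype.card_bool]
    omega
  let f := (Fintype.equivFinOfCardEq hι).symm
  refine ⟨B.submatrix f f, fun i j => hB1 _ _, ?_⟩
  rw [Matrix.transpose_submatrix, Matrix.submatrix_mul_equiv]
  ext i j
  have := hB (f i) (f j)
  simp only [EmbeddingLike.apply_eq_iff_eq] at this
  rw [Matrix.submatrix_apply, Matrix.mul_apply]
  simp only [Matrix.transpose_apply, B, this, Matrix.smul_apply, Matrix.one_apply]
  split_ifs <;> simp
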